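/- arXiv:2507.05877 — 2 statements merged into one kernel-verified Lean document; each statement's English description precedes it below -/
import Mathlib

section
/- For every δ > 0 there exist a positive integer n, an integer k ∈ [n], a probability vector p ∈ (0,1)^n, a cost vector c ∈ ℝ_{≥0}^n, and an adaptive policy π for Stochastic Boolean Function Evaluation of the k-of-n function such that E[cost(π)] > 0 and every non-adaptive policy σ satisfies E[cost(σ)] ≥ (2−δ)·E[cost(π)]. In particular, the adaptivity gap of SBFE on k-of-n functions is at least 2. -/
open Finset

/-- The `k`-of-`n` function: value `1` iff at least `k` of the variables are `1`. -/
def kOfN (n k : ℕ) (x : Fin n → Bool) : Bool :=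
  decide (k ≤ (Finset.univ.filter fun i => x i = true).card)

/-- An outcome `y` is consistent with the state `s ∈ {0,1,•}^n`. -/
def Consistent {n : ℕ} (s : Fin n → Option Bool) (y : Fin n → Bool) : Prop :=
  ∀ i b, s i = some b → y i = b

/-- The `k`-of-`n` function is determined by the state `s`. -/
def Determined (n k : ℕ) (s : Fin n → Option Bool) : Prop :=
  ∀ y z : Fin n → Bool, Consistent s y → Consistent s z → kOfN n k y = kOfN n k z

/-- The state reached after `s` steps of executing the adaptive policy `π` on outcome `x`:
starting from the all-unrevealed state, in each step the value of the prescribed variable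
is revealed. -/
def runState {n : ℕ} (π : (Fin n → Option Bool) → Fin n) (x : Fin n → Bool) :
    ℕ → (Fin n → Option Bool)
  | 0 => fun _ => none
  | s + 1 =>
      let st := runState π x s
      Function.update st (π st) (some (x (π st)))

/-- The cost of the adaptive policy `π` on outcome `x` w.r.t. cost vector `c`: the sum of the
costs of the variables tested until the function is first determined. -/
noncomputable def adaptCost {n : ℕ} (k : ℕ) (c : Fin n → ℝ)
    (π : (Fin n → Option Bool) → Fin n) (x : Fin n → Bool) : ℝ :=
  ∑ i ∈ Finset.univ.filter
      (fun i => runState π x (sInf {s | Determined n k (runState π x s)}) i ≠ none), c i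

/-- The cost of the non-adaptive policy (permutation) `σ` on outcome `x`: the sum of the costs
of the variables `x_{σ(1)}, x_{σ(2)}, …` tested until the function is first determined. -/
noncomputable def naCost {n : ℕ} (k : ℕ) (c : Fin n → ℝ) (σ : Equiv.Perm (Fin n))
    (x : Fin n → Bool) : ℝ :=
  ∑ i ∈ Finset.univ.filter
      (fun i => (σ.symm i : ℕ) < sInf {ℓ | Determined n k
        (fun i' => if (σ.symm i' : ℕ) < ℓ then some (x i') else none)}), c i

/-- Expectation over `x ∈ {0,1}^n` with independent coordinates, `Pr[x_i = 1] = p_i`. -/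
noncomputable def expCost {n : ℕ} (p : Fin n → ℝ) (g : (Fin n → Bool) → ℝ) : ℝ :=
  ∑ x : Fin n → Bool, (∏ i, if x i then p i else 1 - p i) * g x

open Topology
open Filter (Tendsto atTop eventually_ge_atTop tendsto_atTop_add_const_right eventually_all)

/-- The state in which exactly the variables in `R` have been revealed, on outcome `x`. -/
def maskState {n : ℕ} (R : Finset (Fin n)) (x : Fin n → Bool) : Fin n → Option Bool :=
  fun i => if i ∈ R then some (x i) else none

lemma determined_iff {n k : ℕ} (s : Fin n → Option Bool) :
    Determined n k s ↔ k ≤ #{i | s i = some true} ∨ n < k + #{i | s i = some false} := by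
  have compl (y : Fin n → Bool) : #{i | y i = true} + #{i | y i = false} = n := by
    have h := card_filter_add_card_filter_not (s := (univ : Finset (Fin n)))
      (fun i => y i = true)
    simpa using h
  constructor
  · intro h
    have h1 := h (fun i => (s i).getD false) (fun i => (s i).getD true)
      (fun i b hb => by simp [hb]) (fun i b hb => by simp [hb])
    have e1 : #{i | (s i).getD false = true} = #{i | s i = some true} := by
      congr 1; ext i; cases h : s i <;> simp [h]
    have e2 : #{i | (s i).getD true = false} = #{i | s i = some false} := by
      congr 1; ext i; cases h : s i <;> simp [h]
    have h2 := compl fun i => (s i).getD true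
    simp only [kOfN, decide_eq_decide, e1] at h1
    omega
  · rintro (h | h) y z hy hz
    · have key (y : Fin n → Bool) (hy : Consistent s y) : kOfN n k y = true := by
        have : #{i | s i = some true} ≤ #{i | y i = true} :=
          card_le_card fun i hi => by
            simp only [mem_filter, mem_univ, true_and] at hi ⊢
            exact hy i _ hi
        simpa [kOfN] using h.trans this
      rw [key y hy, key z hz]
    · have key (y : Fin n → Bool) (hy : Consistent s y) : kOfN n k y = false := by
        have : #{i | s i = some false} ≤ #{i | y i = false} :=
          card_le_card fun i hi => by
            simp only [mem_filter, mem_univ, true_and] at hi ⊢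
            exact hy i _ hi
        have h2 := compl y
        simp only [kOfN, decide_eq_false_iff_not]
        omega
      rw [key y hy, key z hz]

lemma determined_maskState_iff {n k : ℕ} (R : Finset (Fin n)) (x : Fin n → Bool) :
    Determined n k (maskState R x) ↔
      k ≤ #{i ∈ R | x i = true} ∨ n < k + #{i ∈ R | x i = false} := by
  have e (b : Bool) : #{i | maskState R x i = some b} = #{i ∈ R | x i = b} := by
    congr 1; ext i; simp [maskState]
  rw [determined_iff, e, e]

/-- The set of variables revealed after `t` steps of the policy `π` on outcome `x`. -/
noncomputable def revealed {n : ℕ} (π : (Fin n → Option Bool) → Fin n) (x : Fin n → Bool)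
    (t : ℕ) : Finset (Fin n) :=
  {i | runState π x t i ≠ none}

lemma mem_revealed {n : ℕ} {π : (Fin n → Option Bool) → Fin n} {x : Fin n → Bool} {t : ℕ}
    {i : Fin n} : i ∈ revealed π x t ↔ runState π x t i ≠ none := by
  simp [revealed]

lemma runState_eq {n : ℕ} (π : (Fin n → Option Bool) → Fin n) (x : Fin n → Bool) (t : ℕ) :
    runState π x t = maskState (revealed π x t) x := by
  have key : ∀ t i, runState π x t i = none ∨ runState π x t i = some (x i) := by
    intro t
    induction t with
    | zero => simp [runState]
    | succ t ih =>
      intro i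
      by_cases h : i = π (runState π x t)
      · subst h; simp [runState]
      · simpa [runState, h] using ih i
  ext1 i
  rcases key t i with h | h <;> simp [maskState, revealed, h]

lemma revealed_zero {n : ℕ} (π : (Fin n → Option Bool) → Fin n) (x : Fin n → Bool) :
    revealed π x 0 = ∅ := by
  simp [revealed, runState]

lemma revealed_succ {n : ℕ} (π : (Fin n → Option Bool) → Fin n) (x : Fin n → Bool) (t : ℕ) :
    revealed π x (t + 1) =
      insert (π (maskState (revealed π x t) x)) (revealed π x t) := by
  rw [← runState_eq]
  ext i
  by_cases h : i = π (runState π x t)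
  · simp [mem_revealed, runState, h]
  · simp [mem_revealed, runState, h]

lemma revealed_mono {n : ℕ} (π : (Fin n → Option Bool) → Fin n) (x : Fin n → Bool) :
    Monotone (revealed π x) :=
  monotone_nat_of_le_succ fun t => by
    rw [revealed_succ]; exact subset_insert _ _

/-- If, as long as only variables of `R₀ ∪ P` are revealed, the policy picks unrevealed variables
of `P`, then it reveals one new variable of `P` in every step. -/
lemma revealed_phase {n : ℕ} {π : (Fin n → Option Bool) → Fin n} {x : Fin n → Bool}
    {t : ℕ} {P : Finset (Fin n)} (hd : Disjoint (revealed π x t) P)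
    (hπ : ∀ R, revealed π x t ⊆ R → (P \ R).Nonempty → π (maskState R x) ∈ P \ R)
    (r : ℕ) (hr : r ≤ #P) :
    ∃ Q ⊆ P, #Q = r ∧ revealed π x (t + r) = revealed π x t ∪ Q := by
  induction r with
  | zero => exact ⟨∅, by simp⟩
  | succ r ih =>
    obtain ⟨Q, hQP, hQ, hrev⟩ := ih (by omega)
    have hne : (P \ (revealed π x t ∪ Q)).Nonempty := by
      rw [← sup_eq_union, ← sdiff_sdiff_left, sdiff_eq_self_of_disjoint hd.symm, ← card_pos,
        card_sdiff_of_subset hQP]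
      omega
    have hmem := hπ _ subset_union_left hne
    simp only [mem_sdiff, mem_union, not_or] at hmem
    refine ⟨insert (π (maskState (revealed π x t ∪ Q) x)) Q,
      insert_subset hmem.1 hQP, ?_, ?_⟩
    · rw [card_insert_of_notMem hmem.2.2, hQ]
    · rw [← add_assoc, revealed_succ, hrev, union_insert]

/-- Costs: testing a variable of `A ∪ B` costs `1`, all other variables are free. -/
def indicatorCost {n : ℕ} (A B : Finset (Fin n)) (i : Fin n) : ℝ :=
  if i ∈ A ∪ B then 1 else 0

lemma sum_indicatorCost {n : ℕ} (A B R : Finset (Fin n)) :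
    ∑ i ∈ R, indicatorCost A B i = #(R ∩ (A ∪ B)) := by
  simp [indicatorCost, ← filter_mem_eq_inter]

lemma indicatorCost_nonneg {n : ℕ} (A B : Finset (Fin n)) (i : Fin n) :
    0 ≤ indicatorCost A B i := by
  unfold indicatorCost; split_ifs <;> norm_num

lemma adaptCost_le_of_determined {n k : ℕ} (A B : Finset (Fin n))
    (π : (Fin n → Option Bool) → Fin n) (x : Fin n → Bool) (t : ℕ)
    (h : Determined n k (maskState (revealed π x t) x)) :
    adaptCost k (indicatorCost A B) π x ≤ #(revealed π x t ∩ (A ∪ B)) := by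
  rw [← sum_indicatorCost]
  refine sum_le_sum_of_subset_of_nonneg ?_ fun i _ _ => indicatorCost_nonneg A B i
  refine revealed_mono π x (Nat.sInf_le ?_)
  rwa [← runState_eq] at h

open Classical in
/-- The policy that first tests all variables outside `A ∪ B`; if at least `m` of them are `1`, it
continues with `A` and otherwise with `B`; any remaining variables are tested last. -/
noncomputable def preferredPolicy {n : ℕ} (A B : Finset (Fin n)) (m : ℕ) (i₀ : Fin n)
    (s : Fin n → Option Bool) : Fin n :=
  if h : ∃ i, i ∉ A ∪ B ∧ s i = none then h.choose
  else if h : ∃ i ∈ (if m ≤ #{i ∈ (A ∪ B)ᶜ | s i = some true} then A else B), s i = none then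
    h.choose
  else if h : ∃ i, s i = none then h.choose
  else i₀

lemma preferredPolicy_valid {n : ℕ} (A B : Finset (Fin n)) (m : ℕ) (i₀ : Fin n)
    (s : Fin n → Option Bool) (hs : ∃ i, s i = none) :
    s (preferredPolicy A B m i₀ s) = none := by
  unfold preferredPolicy
  by_cases h1 : ∃ i, i ∉ A ∪ B ∧ s i = none
  · rw [dif_pos h1]
    exact h1.choose_spec.2
  rw [dif_neg h1]
  by_cases h2 : ∃ i ∈ (if m ≤ #{i ∈ (A ∪ B)ᶜ | s i = some true} then A else B), s i = none
  · rw [dif_pos h2]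
    exact h2.choose_spec.2
  · rw [dif_neg h2, dif_pos hs]
    exact hs.choose_spec

lemma preferredPolicy_mem_compl {n : ℕ} (A B : Finset (Fin n)) (m : ℕ) (i₀ : Fin n)
    (R : Finset (Fin n)) (x : Fin n → Bool) (h : ((A ∪ B)ᶜ \ R).Nonempty) :
    preferredPolicy A B m i₀ (maskState R x) ∈ (A ∪ B)ᶜ \ R := by
  obtain ⟨i, hi⟩ := h
  have h' : ∃ i, i ∉ A ∪ B ∧ maskState R x i = none := ⟨i, by simpa [maskState] using hi⟩
  have := h'.choose_spec
  rw [preferredPolicy, dif_pos h', mem_sdiff, mem_compl]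
  refine ⟨this.1, ?_⟩
  simpa [maskState] using this.2

lemma preferredPolicy_mem_preferred {n : ℕ} (A B : Finset (Fin n)) (m : ℕ) (i₀ : Fin n)
    (R : Finset (Fin n)) (x : Fin n → Bool) (hR : (A ∪ B)ᶜ ⊆ R) (P : Finset (Fin n))
    (hP : P = if m ≤ #{i ∈ (A ∪ B)ᶜ | x i = true} then A else B) (h : (P \ R).Nonempty) :
    preferredPolicy A B m i₀ (maskState R x) ∈ P \ R := by
  obtain ⟨i, hi⟩ := h
  have h1 : ¬ ∃ i, i ∉ A ∪ B ∧ maskState R x i = none := by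
    rintro ⟨j, hj, hj'⟩
    have := hR (mem_compl.2 hj)
    simp [maskState, this] at hj'
  have e : ({i ∈ (A ∪ B)ᶜ | maskState R x i = some true} : Finset (Fin n)) =
      {i ∈ (A ∪ B)ᶜ | x i = true} := by
    refine filter_congr fun j hj => ?_
    simp [maskState, hR hj]
  have h2 : ∃ i ∈ (if m ≤ #{i ∈ (A ∪ B)ᶜ | maskState R x i = some true} then A else B),
      maskState R x i = none := by
    rw [e, ← hP]
    exact ⟨i, by simpa [maskState] using hi⟩
  have := h2.choose_spec
  rw [preferredPolicy, dif_neg h1, dif_pos h2, mem_sdiff]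
  refine ⟨?_, ?_⟩
  · exact (Finset.ext_iff.1 (by rw [e, hP]) _).1 this.1
  · simpa [maskState] using this.2

/-- The number of unit-cost variables the adaptive policy tests if exactly `s` free variables
are `1`. -/
def residualTests (N m s : ℕ) : ℕ :=
  if m ≤ s then m + N - s else s + 1 + N - m

lemma adaptCost_preferredPolicy_le {N m n : ℕ} {A B : Finset (Fin n)} (hAB : Disjoint A B)
    (hA : #A = N) (hB : #B = N) (hn : n = 2 * N + 2 * m) (i₀ : Fin n) (x : Fin n → Bool)
    (hxA : ∀ i ∈ A, x i = true) (hxB : ∀ i ∈ B, x i = false) :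
    (∃ t, Determined n (m + N) (runState (preferredPolicy A B m i₀) x t)) ∧
    adaptCost (m + N) (indicatorCost A B) (preferredPolicy A B m i₀) x ≤
      residualTests N m #{i ∈ (A ∪ B)ᶜ | x i = true} := by
  set F := (A ∪ B)ᶜ with hF
  set S := #{i ∈ F | x i = true} with hS
  set π := preferredPolicy A B m i₀
  have hFcard : #F = 2 * m := by
    rw [hF, card_compl, card_union_of_disjoint hAB, Fintype.card_fin]; omega
  have hcount : S + #{i ∈ F | x i = false} = 2 * m := by
    rw [← hFcard, hS, ← card_filter_add_card_filter_not (s := F) (fun i => x i = true)]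
    simp
  obtain ⟨Q₀, hQ₀, hQ₀c, hrev₀⟩ := revealed_phase (π := π) (x := x) (t := 0) (P := F)
    (by simp [revealed_zero])
    (fun R _ h => preferredPolicy_mem_compl A B m i₀ R x h) _ le_rfl
  rw [revealed_zero, empty_union, zero_add, eq_of_subset_of_card_le hQ₀ hQ₀c.ge] at hrev₀
  set P := if m ≤ S then A else B with hP
  have hPAB : P ⊆ A ∪ B := by
    rw [hP]; split_ifs
    exacts [subset_union_left, subset_union_right]
  have hPc : #P = N := by rw [hP]; split_ifs <;> assumption
  have hFP : Disjoint F P := disjoint_compl_left.mono_right hPAB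
  have hTN : residualTests N m S ≤ N := by unfold residualTests; split_ifs <;> omega
  obtain ⟨Q, hQP, hQc, hrev⟩ := revealed_phase (π := π) (x := x) (t := #F) (P := P)
    (by rwa [hrev₀]) (fun R hR h => preferredPolicy_mem_preferred A B m i₀ R x
      (by rwa [hrev₀] at hR) P hP h) (residualTests N m S) (by rw [hPc]; exact hTN)
  rw [hrev₀] at hrev
  have hdet : Determined n (m + N)
      (maskState (revealed π x (#F + residualTests N m S)) x) := by
    rw [hrev, determined_maskState_iff, filter_union, filter_union,
      card_union_of_disjoint, card_union_of_disjoint]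
    rotate_left
    · exact disjoint_filter_filter (hFP.mono_right hQP)
    · exact disjoint_filter_filter (hFP.mono_right hQP)
    by_cases h : m ≤ S
    · left
      have : #{i ∈ Q | x i = true} = #Q := by
        rw [filter_true_of_mem]
        intro i hi
        exact hxA i (by simpa [hP, h] using hQP hi)
      rw [this, hQc, residualTests, if_pos h]
      omega
    · right
      have : #{i ∈ Q | x i = false} = #Q := by
        rw [filter_true_of_mem]
        intro i hi
        exact hxB i (by simpa [hP, h] using hQP hi)
      rw [this, hQc, residualTests, if_neg h]
      omega
  refine ⟨⟨_, by rw [runState_eq]; exact hdet⟩, ?_⟩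
  refine (adaptCost_le_of_determined A B π x _ hdet).trans ?_
  have : (F ∪ Q) ∩ (A ∪ B) = Q := by
    rw [union_inter_distrib_right, inter_eq_left.2 (hQP.trans hPAB),
      disjoint_iff_inter_eq_empty.1 (disjoint_compl_left : Disjoint F (A ∪ B)), empty_union]
  rw [hrev, this, hQc]

lemma adaptCost_pos {n k : ℕ} {A B : Finset (Fin n)} (π : (Fin n → Option Bool) → Fin n)
    (x : Fin n → Bool) (h1 : ∃ t, Determined n k (runState π x t))
    (h2 : ¬ Determined n k (maskState (A ∪ B)ᶜ x)) :
    0 < adaptCost k (indicatorCost A B) π x := by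
  have h := Nat.sInf_mem (s := {t | Determined n k (runState π x t)}) h1
  rw [Set.mem_ofPred_eq, runState_eq] at h
  change 0 < ∑ i ∈ revealed π x _, indicatorCost A B i
  rw [sum_indicatorCost, Nat.cast_pos, card_pos]
  by_contra hne
  rw [not_nonempty_iff_eq_empty, ← disjoint_iff_inter_eq_empty] at hne
  have hsub := subset_compl_iff_disjoint_right.2 hne
  apply h2
  rw [determined_maskState_iff] at h ⊢
  have e (b : Bool) := card_le_card (filter_subset_filter (fun i => x i = b) hsub)
  have := e true
  have := e false
  omega

/-- The variables preceding `u` in the order `σ`. -/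
def before {n : ℕ} (σ : Equiv.Perm (Fin n)) (u : Fin n) : Finset (Fin n) :=
  {v | σ.symm v < σ.symm u}

lemma le_naCost {N m n : ℕ} {A B : Finset (Fin n)} (hAB : Disjoint A B)
    (hA : #A = N) (hB : #B = N) (hn : n = 2 * N + 2 * m) (σ : Equiv.Perm (Fin n))
    (x : Fin n → Bool) (hxA : ∀ i ∈ A, x i = true) (hxB : ∀ i ∈ B, x i = false)
    (s : ℕ) (hs : #{i ∈ (A ∪ B)ᶜ | x i = true} = s) :
    (#{u ∈ A ∪ B | #(A ∩ before σ u) + s < m + N ∧ #(B ∩ before σ u) + m < s + 1 + N} : ℝ) ≤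
      naCost (m + N) (indicatorCost A B) σ x := by
  unfold naCost
  rw [sum_indicatorCost, Nat.cast_le]
  set D := {ℓ | Determined n (m + N)
        (fun i' => if (σ.symm i' : ℕ) < ℓ then some (x i') else none)} with hD
  have hne : D.Nonempty := by
    refine ⟨n, fun y z hy hz => ?_⟩
    have : y = z := funext fun i => by
      rw [hy i (x i) (by simp), hz i (x i) (by simp)]
    rw [this]
  have hmem := Nat.sInf_mem hne
  set L := sInf D
  have hmask : (fun i' => if (σ.symm i' : ℕ) < L then some (x i') else none) =
      maskState {i | (σ.symm i : ℕ) < L} x := by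
    ext1 i; simp [maskState]
  rw [hD, Set.mem_ofPred_eq, hmask, determined_maskState_iff] at hmem
  refine card_le_card fun u hu => ?_
  simp only [mem_filter, mem_inter, mem_univ, true_and] at hu ⊢
  refine ⟨?_, hu.1⟩
  by_contra! hLu
  have hsplit (b : Bool) : #{i ∈ ({i | (σ.symm i : ℕ) < L} : Finset (Fin n)) | x i = b} ≤
      #{i ∈ (A ∪ B)ᶜ | x i = b} + #((if b then A else B) ∩ before σ u) := by
    rw [← card_union_of_disjoint]
    · refine card_le_card fun i hi => ?_
      simp only [mem_filter, mem_univ, true_and] at hi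
      have hlt : σ.symm i < σ.symm u := Fin.lt_def.2 (hi.1.trans_le hLu)
      simp only [mem_union, mem_filter, mem_compl, mem_inter, before, mem_univ, hlt, and_true]
      by_cases hiA : i ∈ A
      · have := hxA i hiA; grind
      · by_cases hiB : i ∈ B
        · have := hxB i hiB; grind
        · grind
    · rw [disjoint_left]
      intro i hi hi'
      simp only [mem_filter, mem_compl, mem_union, not_or, mem_inter] at hi hi'
      cases b <;> simp_all
  have ht := hsplit true
  have hf := hsplit false
  have hFcard : #(A ∪ B)ᶜ = 2 * m := by
    rw [card_compl, card_union_of_disjoint hAB, Fintype.card_fin]; omega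
  have hcount : #{i ∈ (A ∪ B)ᶜ | x i = true} + #{i ∈ (A ∪ B)ᶜ | x i = false} = 2 * m := by
    rw [← hFcard, ← card_filter_add_card_filter_not (s := (A ∪ B)ᶜ) (fun i => x i = true)]
    simp
  simp only [if_true, Bool.false_eq_true, if_false] at ht hf
  omega

lemma two_mul_sum_card_before {n : ℕ} (σ : Equiv.Perm (Fin n)) (C : Finset (Fin n)) :
    2 * ∑ u ∈ C, #(C ∩ before σ u) + #C = #C * #C := by
  have h1 : ∑ u ∈ C, #(C ∩ before σ u) =
      ∑ u ∈ C, ∑ v ∈ C, if σ.symm v < σ.symm u then 1 else 0 := by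
    refine sum_congr rfl fun u _ => ?_
    rw [← card_filter]
    congr 1; ext v; simp [before]
  have h2 : ∑ u ∈ C, #(C ∩ before σ u) =
      ∑ u ∈ C, ∑ v ∈ C, if σ.symm u < σ.symm v then 1 else 0 := by
    rw [h1, sum_comm]
  have h3 : #C = ∑ u ∈ C, ∑ v ∈ C, if u = v then 1 else 0 := by
    simp
  calc 2 * ∑ u ∈ C, #(C ∩ before σ u) + #C
      = ∑ u ∈ C, ∑ v ∈ C, ((if σ.symm v < σ.symm u then 1 else 0) +
          (if σ.symm u < σ.symm v then 1 else 0) + if u = v then 1 else 0) := by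
        simp only [sum_add_distrib]
        rw [← h1, ← h2, ← h3]; ring
    _ = ∑ u ∈ C, ∑ v ∈ C, 1 := by
        refine sum_congr rfl fun u _ => sum_congr rfl fun v _ => ?_
        rcases lt_trichotomy (σ.symm u) (σ.symm v) with h | h | h
        · have : u ≠ v := by rintro rfl; exact lt_irrefl _ h
          simp [h, h.not_gt, this]
        · simp [σ.symm.injective h]
        · have : u ≠ v := by rintro rfl; exact lt_irrefl _ h
          simp [h, h.not_gt, this]
    _ = #C * #C := by simp

lemma le_sum_card_untested {N m n : ℕ} {A B : Finset (Fin n)} (hAB : Disjoint A B)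
    (hA : #A = N) (hB : #B = N) (hNm : N ≤ m) (σ : Equiv.Perm (Fin n)) :
    N * (2 * N + 1) ≤ ∑ s ∈ Ico (m - N) (m + N), #{u ∈ A ∪ B |
      #(A ∩ before σ u) + s < m + N ∧ #(B ∩ before σ u) + m < s + 1 + N} := by
  have hC : #(A ∪ B) = 2 * N := by rw [card_union_of_disjoint hAB]; omega
  have h1 (u : Fin n) : 2 * N ≤ #{s ∈ Ico (m - N) (m + N) | #(A ∩ before σ u) + s < m + N ∧
      #(B ∩ before σ u) + m < s + 1 + N} + #((A ∪ B) ∩ before σ u) := by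
    rw [union_inter_distrib_right, card_union_of_disjoint
      (hAB.mono inter_subset_left inter_subset_left)]
    have : Ico (#(B ∩ before σ u) + m - N) (m + N - #(A ∩ before σ u)) ⊆
        {s ∈ Ico (m - N) (m + N) | #(A ∩ before σ u) + s < m + N ∧
          #(B ∩ before σ u) + m < s + 1 + N} := by
      intro s hs
      simp only [mem_filter, mem_Ico] at hs ⊢
      omega
    have := card_le_card this
    rw [Nat.card_Ico] at this
    omega
  have h2 := sum_le_sum fun u (_ : u ∈ A ∪ B) => h1 u
  rw [sum_const, smul_eq_mul, hC, sum_add_distrib] at h2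
  have h3 := two_mul_sum_card_before σ (A ∪ B)
  rw [hC] at h3
  simp only [card_filter] at h2 ⊢
  rw [sum_comm] at h2
  nlinarith

lemma sum_residualTests_le (N m : ℕ) :
    ∑ s ∈ range (2 * m + 1), residualTests N m s ≤ N * (N + 1) := by
  have tri (M : ℕ) : (∑ i ∈ range M, (N - i)) * 2 ≤ N * (N + 1) := by
    have : (∑ i ∈ range M, (N - i)) * 2 + (N - M) * (N - M + 1) = N * (N + 1) := by
      induction M with
      | zero => simp
      | succ M ih =>
        rw [← ih, sum_range_succ]
        rcases le_or_gt N M with h | h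
        · simp [Nat.sub_eq_zero_of_le h, Nat.sub_eq_zero_of_le (h.trans M.le_succ)]
        · obtain ⟨d, rfl⟩ := Nat.exists_eq_add_of_lt h
          rw [show M + d + 1 - M = d + 1 by omega, show M + d + 1 - (M + 1) = d by omega]
          ring
    omega
  have e1 : ∑ s ∈ range m, residualTests N m s = ∑ i ∈ range m, (N - i) := by
    rw [← sum_range_reflect]
    refine sum_congr rfl fun i hi => ?_
    rw [mem_range] at hi
    rw [residualTests, if_neg (by omega)]
    omega
  have e2 : ∑ i ∈ range (m + 1), residualTests N m (m + i) = ∑ i ∈ range (m + 1), (N - i) := by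
    refine sum_congr rfl fun i _ => ?_
    rw [residualTests, if_pos (by omega)]
    omega
  rw [show 2 * m + 1 = m + (m + 1) by ring, sum_range_add, e1, e2]
  have := tri m
  have := tri (m + 1)
  omega

lemma choose_sub_le_choose {N m s : ℕ} (h1 : m - N ≤ s) (h2 : s ≤ m + N) (hNm : N ≤ m) :
    (2 * m).choose (m - N) ≤ (2 * m).choose s := by
  have mono : ∀ r, m - N ≤ r → r ≤ m → (2 * m).choose (m - N) ≤ (2 * m).choose r := by
    intro r hr
    induction r, hr using Nat.le_induction with
    | base => intro _; exact le_rfl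
    | succ r hr ih =>
      intro hrm
      exact (ih (by omega)).trans (Nat.choose_le_succ_of_lt_half_left (by omega))
  rcases le_total s m with h | h
  · exact mono s h1 h
  · rw [← Nat.choose_symm (show s ≤ 2 * m by omega)]
    exact mono _ (by omega) (by omega)

lemma tendsto_choose_ratio (N : ℕ) :
    Tendsto (fun m : ℕ => ((2 * m).choose (m - N) : ℝ) / (2 * m).choose m) atTop (𝓝 1) := by
  induction N with
  | zero =>
    refine tendsto_const_nhds.congr fun m => ?_
    have : ((2 * m).choose m : ℝ) ≠ 0 := by
      exact_mod_cast (Nat.choose_pos (by omega)).ne'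
    simp [this]
  | succ N ih =>
    have h : Tendsto (fun m : ℕ => ((m : ℝ) - N) / (m + (N + 1))) atTop (𝓝 1) := by
      have h1 : Tendsto (fun m : ℕ => 1 - (2 * N + 1 : ℝ) / (m + (N + 1))) atTop
          (𝓝 (1 - 0)) := by
        refine tendsto_const_nhds.sub (tendsto_const_nhds.div_atTop ?_)
        exact tendsto_atTop_add_const_right _ _ tendsto_natCast_atTop_atTop
      rw [sub_zero] at h1
      refine h1.congr fun m => ?_
      have : (m : ℝ) + (N + 1) ≠ 0 := by positivity
      field_simp
      ring
    have h2 := ih.mul h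
    rw [one_mul] at h2
    refine h2.congr' ?_
    filter_upwards [eventually_ge_atTop (N + 1)] with m hm
    have e := Nat.choose_succ_right_eq (2 * m) (m - (N + 1))
    rw [show m - (N + 1) + 1 = m - N by omega,
      show 2 * m - (m - (N + 1)) = m + (N + 1) by omega] at e
    have e' : ((2 * m).choose (m - N) : ℝ) * (m - N) =
        (2 * m).choose (m - (N + 1)) * (m + (N + 1)) := by
      rw [← Nat.cast_sub (by omega : N ≤ m)]
      exact_mod_cast e
    have : ((2 * m).choose m : ℝ) ≠ 0 := by
      exact_mod_cast (Nat.choose_pos (by omega)).ne'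
    have : (m : ℝ) + (N + 1) ≠ 0 := by positivity
    rw [div_mul_div_comm, e']
    field_simp

/-- Success probabilities `1 - η` on `A`, `η` on `B` and `1 / 2` on the remaining variables. -/
noncomputable def successProb {n : ℕ} (A B : Finset (Fin n)) (η : ℝ) (i : Fin n) : ℝ :=
  if i ∈ A then 1 - η else if i ∈ B then η else 1 / 2

/-- The outcome with `1` exactly on `A ∪ U`. -/
def outcome {n : ℕ} (A U : Finset (Fin n)) (i : Fin n) : Bool :=
  decide (i ∈ A ∪ U)

lemma expCost_successProb_zero {m n : ℕ} {A B : Finset (Fin n)} (hAB : Disjoint A B)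
    (hF : #(A ∪ B)ᶜ = 2 * m) (g : (Fin n → Bool) → ℝ) :
    expCost (successProb A B 0) g =
      (1 / 2) ^ (2 * m) * ∑ U ∈ (A ∪ B)ᶜ.powerset, g (outcome A U) := by
  have hinj : Set.InjOn (outcome A) ((A ∪ B)ᶜ.powerset : Set (Finset (Fin n))) := by
    intro U hU V hV h
    ext i
    have hi := congrFun h i
    simp only [outcome, decide_eq_decide, mem_union] at hi
    have hU' : i ∈ U → i ∈ (A ∪ B)ᶜ := fun h => mem_powerset.1 hU h
    have hV' : i ∈ V → i ∈ (A ∪ B)ᶜ := fun h => mem_powerset.1 hV h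
    simp only [mem_compl, mem_union] at hU' hV'
    tauto
  rw [expCost, mul_sum, ← sum_image (f := fun x => (1 / 2) ^ (2 * m) * g x) hinj]
  symm
  refine (sum_subset_zero_on_sdiff (subset_univ _) ?_ ?_)
  · intro x hx
    simp only [mem_sdiff, mem_univ, true_and, mem_image, not_exists, not_and] at hx
    suffices h : ∃ i, (if x i then successProb A B 0 i else 1 - successProb A B 0 i) = 0 by
      obtain ⟨i, hi⟩ := h
      rw [prod_eq_zero (mem_univ i) hi, zero_mul]
    by_contra! hne
    refine hx {i ∈ (A ∪ B)ᶜ | x i = true} (mem_powerset.2 (filter_subset _ _)) ?_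
    ext1 i
    have := hne i
    have hd : i ∈ A → i ∉ B := fun h => disjoint_left.1 hAB h
    by_cases hiA : i ∈ A
    · cases h : x i <;> simp_all [outcome, successProb]
    · by_cases hiB : i ∈ B
      · cases h : x i <;> simp_all [outcome, successProb]
      · cases h : x i <;> simp_all [outcome]
  · intro x hx
    obtain ⟨U, hU, rfl⟩ := mem_image.1 hx
    congr 1
    have hval (i : Fin n) : (if outcome A U i then successProb A B 0 i
        else 1 - successProb A B 0 i) = if i ∈ (A ∪ B)ᶜ then 1 / 2 else 1 := by
      have hd : i ∈ A → i ∉ B := fun h => disjoint_left.1 hAB h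
      have hU' : i ∈ U → i ∈ (A ∪ B)ᶜ := fun h => mem_powerset.1 hU h
      simp only [mem_compl, mem_union] at hU'
      by_cases hiA : i ∈ A
      · simp [outcome, successProb, hiA]
      · by_cases hiB : i ∈ B
        · have : i ∉ U := by tauto
          simp [outcome, successProb, hiA, hiB, this]
        · by_cases hiU : i ∈ U <;> simp [outcome, successProb, hiA, hiB, hiU]; norm_num
    rw [prod_congr rfl fun i _ => hval i, prod_ite_mem, univ_inter, prod_const, hF]

lemma continuous_expCost_successProb {n : ℕ} (A B : Finset (Fin n))
    (g : (Fin n → Bool) → ℝ) : Continuous fun η => expCost (successProb A B η) g := by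
  unfold expCost
  refine continuous_finsetSum _ fun x _ => Continuous.mul ?_ continuous_const
  refine continuous_finsetProd _ fun i _ => ?_
  unfold successProb
  split_ifs <;> fun_prop

lemma card_filter_outcome {n : ℕ} {A B U : Finset (Fin n)} (hU : U ⊆ (A ∪ B)ᶜ) :
    #{i ∈ (A ∪ B)ᶜ | outcome A U i = true} = #U := by
  congr 1
  ext i
  have hU' := @hU i
  simp only [outcome, mem_filter, mem_compl, mem_union, decide_eq_true_eq] at hU' ⊢
  tauto

lemma outcome_left {n : ℕ} {A U : Finset (Fin n)} {i : Fin n} (hi : i ∈ A) :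
    outcome A U i = true := by
  simp [outcome, hi]

lemma outcome_right {n : ℕ} {A B U : Finset (Fin n)} (hAB : Disjoint A B)
    (hU : U ⊆ (A ∪ B)ᶜ) {i : Fin n} (hi : i ∈ B) : outcome A U i = false := by
  have h1 : i ∉ U := fun h => by simpa [hi] using hU h
  simp [outcome, disjoint_right.1 hAB hi, h1]

lemma expCost_adaptCost_le {N m n : ℕ} {A B : Finset (Fin n)} (hAB : Disjoint A B)
    (hA : #A = N) (hB : #B = N) (hn : n = 2 * N + 2 * m) (hF : #(A ∪ B)ᶜ = 2 * m)
    (i₀ : Fin n) :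
    expCost (successProb A B 0)
        (adaptCost (m + N) (indicatorCost A B) (preferredPolicy A B m i₀)) ≤
      (1 / 2) ^ (2 * m) * ((2 * m).choose m * (N * (N + 1))) := by
  rw [expCost_successProb_zero hAB hF]
  gcongr
  calc ∑ U ∈ (A ∪ B)ᶜ.powerset, adaptCost (m + N) (indicatorCost A B)
          (preferredPolicy A B m i₀) (outcome A U)
      ≤ ∑ U ∈ (A ∪ B)ᶜ.powerset, (residualTests N m #U : ℝ) := by
        refine sum_le_sum fun U hU => ?_
        rw [mem_powerset] at hU
        have := (adaptCost_preferredPolicy_le hAB hA hB hn i₀ (outcome A U)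
          (fun _ => outcome_left) (fun _ => outcome_right hAB hU)).2
        rwa [card_filter_outcome hU] at this
    _ = ∑ s ∈ range (2 * m + 1), ((2 * m).choose s * residualTests N m s : ℝ) := by
        rw [sum_powerset_apply_card (fun s => (residualTests N m s : ℝ)), hF]
        simp
    _ ≤ ∑ s ∈ range (2 * m + 1), ((2 * m).choose m * residualTests N m s : ℝ) := by
        refine sum_le_sum fun s _ => ?_
        gcongr
        simpa using Nat.choose_le_middle s (2 * m)
    _ ≤ (2 * m).choose m * (N * (N + 1)) := by
        rw [← mul_sum]
        gcongr
        exact_mod_cast sum_residualTests_le N m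

lemma le_expCost_naCost {N m n : ℕ} {A B : Finset (Fin n)} (hAB : Disjoint A B)
    (hA : #A = N) (hB : #B = N) (hn : n = 2 * N + 2 * m) (hF : #(A ∪ B)ᶜ = 2 * m)
    (hNm : N ≤ m) (σ : Equiv.Perm (Fin n)) :
    (1 / 2) ^ (2 * m) * ((2 * m).choose (m - N) * (N * (2 * N + 1))) ≤
      expCost (successProb A B 0) (naCost (m + N) (indicatorCost A B) σ) := by
  rw [expCost_successProb_zero hAB hF]
  gcongr
  set G : ℕ → ℕ := fun s => #{u ∈ A ∪ B | #(A ∩ before σ u) + s < m + N ∧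
    #(B ∩ before σ u) + m < s + 1 + N} with hG
  calc ((2 * m).choose (m - N) * (N * (2 * N + 1)) : ℝ)
      ≤ (2 * m).choose (m - N) * ∑ s ∈ Ico (m - N) (m + N), (G s : ℝ) := by
        gcongr
        exact_mod_cast le_sum_card_untested hAB hA hB hNm σ
    _ ≤ ∑ s ∈ Ico (m - N) (m + N), ((2 * m).choose s * G s : ℝ) := by
        rw [mul_sum]
        refine sum_le_sum fun s hs => ?_
        rw [mem_Ico] at hs
        gcongr
        exact choose_sub_le_choose hs.1 hs.2.le hNm
    _ ≤ ∑ s ∈ range (2 * m + 1), ((2 * m).choose s * G s : ℝ) := by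
        refine sum_le_sum_of_subset_of_nonneg (fun s hs => ?_) fun _ _ _ => by positivity
        rw [mem_Ico] at hs
        rw [mem_range]
        omega
    _ = ∑ U ∈ (A ∪ B)ᶜ.powerset, (G #U : ℝ) := by
        rw [sum_powerset_apply_card (fun s => (G s : ℝ)), hF]
        simp
    _ ≤ ∑ U ∈ (A ∪ B)ᶜ.powerset,
          naCost (m + N) (indicatorCost A B) σ (outcome A U) := by
        refine sum_le_sum fun U hU => ?_
        rw [mem_powerset] at hU
        exact le_naCost hAB hA hB hn σ (outcome A U)
          (fun _ => outcome_left) (fun _ => outcome_right hAB hU) _ (card_filter_outcome hU)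

lemma expCost_adaptCost_pos {N m n : ℕ} {A B : Finset (Fin n)} (hAB : Disjoint A B)
    (hA : #A = N) (hB : #B = N) (hn : n = 2 * N + 2 * m) (hF : #(A ∪ B)ᶜ = 2 * m)
    (hN : 0 < N) (i₀ : Fin n) (p : Fin n → ℝ) (hp : ∀ i, 0 < p i ∧ p i < 1) :
    0 < expCost p (adaptCost (m + N) (indicatorCost A B) (preferredPolicy A B m i₀)) := by
  obtain ⟨U, hU, hUc⟩ := exists_subset_card_eq (show m ≤ #(A ∪ B)ᶜ by omega)
  have hw (x : Fin n → Bool) : 0 < ∏ i, if x i then p i else 1 - p i := by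
    refine prod_pos fun i _ => ?_
    split_ifs
    · exact (hp i).1
    · linarith [(hp i).2]
  refine sum_pos' (fun x _ => mul_nonneg (hw x).le
    (sum_nonneg fun i _ => indicatorCost_nonneg A B i))
    ⟨outcome A U, mem_univ _, mul_pos (hw _) ?_⟩
  refine adaptCost_pos _ _ (adaptCost_preferredPolicy_le hAB hA hB hn i₀ (outcome A U)
    (fun _ => outcome_left) (fun _ => outcome_right hAB hU)).1 ?_
  have hcount : #{i ∈ (A ∪ B)ᶜ | outcome A U i = true} +
      #{i ∈ (A ∪ B)ᶜ | outcome A U i = false} = 2 * m := by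
    rw [← hF, ← card_filter_add_card_filter_not (s := (A ∪ B)ᶜ)
      (fun i => outcome A U i = true)]
    simp
  rw [card_filter_outcome hU] at hcount
  rw [determined_maskState_iff, card_filter_outcome hU]
  omega

lemma exists_parameters {δ : ℝ} (hδ : 0 < δ) :
    ∃ N m : ℕ, 0 < N ∧ N ≤ m ∧ (2 - δ) * ((2 * m).choose m * (N * (N + 1))) <
      (2 * m).choose (m - N) * (N * (2 * N + 1) : ℝ) := by
  obtain ⟨N, hN⟩ := exists_nat_gt (1 / δ)
  rw [div_lt_iff₀ hδ] at hN
  have hN0 : 0 < N := by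
    rcases Nat.eq_zero_or_pos N with rfl | h
    · norm_num at hN
    · exact h
  have hr : (2 - δ) * (N + 1) / (2 * N + 1) < 1 := by
    rw [div_lt_one (by positivity)]
    nlinarith
  obtain ⟨m, hm, hNm⟩ := (((tendsto_choose_ratio N).eventually (lt_mem_nhds hr)).and
    (eventually_ge_atTop N)).exists
  refine ⟨N, m, hN0, hNm, ?_⟩
  have hc : (0 : ℝ) < (2 * m).choose m := by exact_mod_cast Nat.choose_pos (by omega)
  have hN0' : (0 : ℝ) < N := by exact_mod_cast hN0
  rw [div_lt_div_iff₀ (by positivity) hc] at hm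
  nlinarith [mul_lt_mul_of_pos_left hm hN0']

/-- For every `δ > 0` there are `n`, `k ∈ [n]`, a probability vector
`p ∈ (0,1)^n`, a cost vector `c ∈ ℝ_{≥0}^n`, and an adaptive policy `π` for SBFE of the
`k`-of-`n` function such that `E[cost(π)] > 0` and every non-adaptive policy `σ` satisfies
`E[cost(σ)] ≥ (2−δ)·E[cost(π)]`; i.e. the adaptivity gap of SBFE on `k`-of-`n` functions is
at least `2`. -/
theorem stmt_5 (δ : ℝ) (hδ : 0 < δ) :
    ∃ (n k : ℕ) (p c : Fin n → ℝ) (π : (Fin n → Option Bool) → Fin n),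
      1 ≤ k ∧ k ≤ n ∧
      (∀ i, 0 < p i ∧ p i < 1) ∧ (∀ i, 0 ≤ c i) ∧
      (∀ s : Fin n → Option Bool, (∃ i, s i = none) → s (π s) = none) ∧
      0 < expCost p (adaptCost k c π) ∧
      ∀ σ : Equiv.Perm (Fin n),
        (2 - δ) * expCost p (adaptCost k c π) ≤ expCost p (naCost k c σ) := by
  wlog hδ1 : δ ≤ 1 generalizing δ
  · obtain ⟨n, k, p, c, π, h1, h2, h3, h4, h5, h6, h7⟩ := this 1 one_pos le_rfl
    refine ⟨n, k, p, c, π, h1, h2, h3, h4, h5, h6, fun σ => (h7 σ).trans' ?_⟩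
    gcongr
    exact (not_le.1 hδ1).le
  obtain ⟨N, m, hN, hNm, hlt⟩ := exists_parameters hδ
  obtain ⟨n, hn⟩ : ∃ n, n = 2 * N + 2 * m := ⟨_, rfl⟩
  obtain ⟨A, -, hA⟩ := exists_subset_card_eq
    (show N ≤ #(univ : Finset (Fin n)) by rw [card_fin]; omega)
  obtain ⟨B, hBA, hB⟩ := exists_subset_card_eq
    (show N ≤ #Aᶜ by rw [card_compl, Fintype.card_fin]; omega)
  have hAB : Disjoint A B := (subset_compl_iff_disjoint_right.1 hBA).symm
  have hF : #(A ∪ B)ᶜ = 2 * m := by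
    rw [card_compl, card_union_of_disjoint hAB, Fintype.card_fin]; omega
  let i₀ : Fin n := ⟨0, by omega⟩
  set π := preferredPolicy A B m i₀
  set c := indicatorCost A B
  have hlim (σ : Equiv.Perm (Fin n)) : ∀ᶠ η in 𝓝 (0 : ℝ),
      (2 - δ) * expCost (successProb A B η) (adaptCost (m + N) c π) <
        expCost (successProb A B η) (naCost (m + N) c σ) := by
    refine ((continuous_expCost_successProb A B _).const_mul _).continuousAt.eventually_lt
      (continuous_expCost_successProb A B _).continuousAt ?_
    refine lt_of_lt_of_le ?_ (le_expCost_naCost hAB hA hB hn hF hNm σ)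
    calc _ ≤ (2 - δ) * ((1 / 2) ^ (2 * m) * ((2 * m).choose m * (N * (N + 1)))) :=
          mul_le_mul_of_nonneg_left (expCost_adaptCost_le hAB hA hB hn hF i₀) (by linarith)
      _ = (1 / 2) ^ (2 * m) * ((2 - δ) * ((2 * m).choose m * (N * (N + 1)))) := by ring
      _ < _ := mul_lt_mul_of_pos_left hlt (by positivity)
  obtain ⟨η, hη, hη0, hη1⟩ := (((eventually_all.2 hlim).filter_mono nhdsWithin_le_nhds).and
    (Ioo_mem_nhdsGT (zero_lt_one' ℝ))).exists
  have hp (i : Fin n) : 0 < successProb A B η i ∧ successProb A B η i < 1 := by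
    unfold successProb
    split_ifs <;> constructor <;> linarith
  exact ⟨n, m + N, successProb A B η, c, π, by omega, by omega, hp, indicatorCost_nonneg A B,
    preferredPolicy_valid A B m i₀, expCost_adaptCost_pos hAB hA hB hn hF hN i₀ _ hp,
    fun σ => (hη σ).le⟩
end

section
/- Let ε > 0 and let a, a' be integers with 2(1+ε)²/ε ≤ a < a' ≤ n. Let π* be a non-adaptive policy (a permutation of [n]) and let V*_1,…,V*_b be its consecutive blocks: V*_i = {π*(L_{i−1}+1),…,π*(L_i)} where L_0 = 0 and L_i = Σ_{i'=1}^{i} |V*_{i'}|. Assume |V*_1| = ⌊(a−1)/(1+2ε)⌋, |V*_i| ≤ ⌈ε|V*_1|⌉ for all 2 ≤ i ≤ b, and L_b ≥ a'. Let V_1,…,V_b be pairwise disjoint subsets of [n] with ∪_{i'=1}^{i} V_{i'} ⪰ ∪_{i'=1}^{i} V*_{i'} for all i ∈ [b] and |V_i| ≤ (1+2ε)|V*_i| for all i ∈ [b], and let π be a partial non-adaptive policy that first tests all variables of V_1 (in any order), then all of V_2, and so on through V_b. Then for every integer ℓ with a ≤ ℓ ≤ a', Pr[cost(π) ≥ ℓ]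 ≤ Pr[(1+2ε)³·cost(π*) ≥ ℓ]. -/
open Finset

/-- Among the first `ℓ` tests of the partial non-adaptive policy `σ` on outcome `x`,
there are at least `k` ones or at least `n−k+1` zeros. -/
def Stops (n k : ℕ) (σ : List (Fin n)) (x : Fin n → Bool) (ℓ : ℕ) : Prop :=
  k ≤ ((σ.take ℓ).filter fun i => x i).length ∨
    n - k + 1 ≤ ((σ.take ℓ).filter fun i => !x i).length

open Classical in
/-- The cost of a partial non-adaptive policy `σ` on outcome `x`: the least `ℓ ≤ length σ`
with at least `k` ones or at least `n−k+1` zeros among the first `ℓ` tests, and `n` if no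
such `ℓ` exists. -/
noncomputable def cost (n k : ℕ) (σ : List (Fin n)) (x : Fin n → Bool) : ℕ :=
  if ∃ ℓ ≤ σ.length, Stops n k σ x ℓ then sInf {ℓ | Stops n k σ x ℓ} else n

open Classical in
/-- `Pr[P]` with respect to the product measure on `{0,1}^n` where `Pr[x_i = 1] = p_i`. -/
noncomputable def pr {n : ℕ} (p : Fin n → ℝ) (P : (Fin n → Bool) → Prop) : ℝ :=
  ∑ x : Fin n → Bool, if P x then (∏ i, if x i then p i else 1 - p i) else 0

/-- `V ⪰ V*`: `|V| ≥ |V*|` and for every `h ∈ [n]`, `|V ∩ [h]| ≥ |V* ∩ [h]|` and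
`|V ∩ [−h]| ≥ |V* ∩ [−h]|` (elements of `[n]` represented by `Fin n`, `[h]` by
`{i : (i:ℕ) < h}`, `[−h]` by `{i : n − h ≤ (i:ℕ)}`). -/
def Dominates {n : ℕ} (V Vs : Finset (Fin n)) : Prop :=
  Vs.card ≤ V.card ∧
  ∀ h ∈ Finset.Icc 1 n,
    (Vs.filter fun i : Fin n => (i : ℕ) < h).card ≤
      (V.filter fun i : Fin n => (i : ℕ) < h).card ∧
    (Vs.filter fun i : Fin n => n - h ≤ (i : ℕ)).card ≤
      (V.filter fun i : Fin n => n - h ≤ (i : ℕ)).card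

/-- The probability of the outcome `x` under the product measure. -/
noncomputable def outcomeWeight {n : ℕ} (p : Fin n → ℝ) (x : Fin n → Bool) : ℝ :=
  ∏ i, if x i then p i else 1 - p i

section ProductMeasure

variable {n : ℕ} {p : Fin n → ℝ}

open Classical in
lemma pr_eq_sum_outcomeWeight (P : (Fin n → Bool) → Prop) :
    pr p P = ∑ x, if P x then outcomeWeight p x else 0 := rfl

lemma outcomeWeight_nonneg (hp : ∀ i, 0 ≤ p i ∧ p i ≤ 1) (x : Fin n → Bool) :
    0 ≤ outcomeWeight p x := by
  refine Finset.prod_nonneg fun i _ => ?_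
  split_ifs
  · exact (hp i).1
  · linarith [(hp i).2]

lemma pr_mono (hp : ∀ i, 0 ≤ p i ∧ p i ≤ 1) {P Q : (Fin n → Bool) → Prop}
    (h : ∀ x, P x → Q x) : pr p P ≤ pr p Q := by
  simp only [pr_eq_sum_outcomeWeight]
  refine Finset.sum_le_sum fun x _ => ?_
  have := outcomeWeight_nonneg hp x
  have := h x
  split_ifs <;> first | linarith | tauto

lemma pr_congr {P Q : (Fin n → Bool) → Prop} (h : ∀ x, P x ↔ Q x) : pr p P = pr p Q := by
  rw [show P = Q from funext fun x => propext (h x)]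

lemma pr_or {P Q : (Fin n → Bool) → Prop} (h : ∀ x, P x → ¬ Q x) :
    pr p (fun x => P x ∨ Q x) = pr p P + pr p Q := by
  simp only [pr_eq_sum_outcomeWeight]
  rw [← Finset.sum_add_distrib]
  refine Finset.sum_congr rfl fun x _ => ?_
  by_cases hP : P x <;> by_cases hQ : Q x <;> simp [hP, hQ]
  exact absurd hQ (h x hP)

lemma pr_and_add_pr_and_not (P Q : (Fin n → Bool) → Prop) :
    pr p P = pr p (fun x => P x ∧ Q x) + pr p (fun x => P x ∧ ¬ Q x) := by
  rw [← pr_or (by tauto)]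
  exact pr_congr (by tauto)

lemma pr_comp_not (P : (Fin n → Bool) → Prop) :
    pr (fun i => 1 - p i) (fun x => P fun i => !x i) = pr p P := by
  classical
  let e : (Fin n → Bool) ≃ (Fin n → Bool) :=
    Function.Involutive.toPerm (fun x i => !x i) (fun x => by ext; simp)
  simp only [pr]
  rw [← Equiv.sum_comp e]
  refine Finset.sum_congr rfl fun x _ => ?_
  have he : ∀ i, e x i = !x i := fun _ => rfl
  simp only [he, Bool.not_not]
  refine if_congr Iff.rfl (Finset.prod_congr rfl fun i _ => ?_) rfl
  cases x i <;> simp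

lemma outcomeWeight_update (x : Fin n → Bool) (i : Fin n) (β : Bool) :
    outcomeWeight p (Function.update x i β) =
      (if β then p i else 1 - p i) * ∏ j ∈ univ.erase i, if x j then p j else 1 - p j := by
  rw [outcomeWeight, ← Finset.mul_prod_erase _ _ (mem_univ i)]
  congr 1
  · simp
  · refine Finset.prod_congr rfl fun j hj => ?_
    rw [Function.update_of_ne (Finset.ne_of_mem_erase hj)]

lemma pr_and_coord_mul (i : Fin n) {P : (Fin n → Bool) → Prop}
    (hP : ∀ x β, P (Function.update x i β) ↔ P x) :
    pr p (fun x => P x ∧ x i = true) * (1 - p i) =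
      pr p (fun x => P x ∧ ¬ x i = true) * p i := by
  classical
  let e : (Fin n → Bool) ≃ (Fin n → Bool) :=
    Function.Involutive.toPerm (fun x => Function.update x i (!x i)) (fun x => by simp)
  simp only [pr_eq_sum_outcomeWeight]
  rw [← Equiv.sum_comp e, Finset.sum_mul, Finset.sum_mul]
  refine Finset.sum_congr rfl fun x _ => ?_
  have he : e x = Function.update x i (!x i) := rfl
  simp only [he, hP, Function.update_self, outcomeWeight_update]
  have hx := outcomeWeight_update (p := p) x i (x i)
  rw [Function.update_eq_self] at hx
  rw [hx]
  cases x i <;> by_cases h : P x <;> simp [h]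
  ring

lemma pr_and_coord (i : Fin n) {P : (Fin n → Bool) → Prop}
    (hP : ∀ x β, P (Function.update x i β) ↔ P x) :
    pr p (fun x => P x ∧ x i = true) = p i * pr p P ∧
      pr p (fun x => P x ∧ ¬ x i = true) = (1 - p i) * pr p P := by
  have h₁ := pr_and_coord_mul (p := p) i hP
  have h₂ := pr_and_add_pr_and_not (p := p) P (fun x => x i = true)
  constructor
  · rw [h₂]; linear_combination h₁
  · rw [h₂]; linear_combination -h₁

/-- Recursion for the upper tail of the number of ones in a set of variables. -/
lemma pr_card_insert {S : Finset (Fin n)} {i : Fin n} (hi : i ∉ S) (t : ℕ) :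
    pr p (fun x => t + 1 ≤ #{j ∈ insert i S | x j = true}) =
      p i * pr p (fun x => t ≤ #{j ∈ S | x j = true}) +
        (1 - p i) * pr p (fun x => t + 1 ≤ #{j ∈ S | x j = true}) := by
  have hinv : ∀ (t : ℕ) (x : Fin n → Bool) (β : Bool),
      t ≤ #{j ∈ S | Function.update x i β j = true} ↔ t ≤ #{j ∈ S | x j = true} := by
    intro t x β
    have h : ∀ j ∈ S, Function.update x i β j = true ↔ x j = true := fun j hj => by
      rw [Function.update_of_ne (ne_of_mem_of_not_mem hj hi)]
    rw [Finset.filter_congr h]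
  rw [← (pr_and_coord i (hinv t)).1, ← (pr_and_coord i (hinv (t + 1))).2,
    pr_and_add_pr_and_not _ (fun x => x i = true)]
  have hi' : ∀ x : Fin n → Bool, i ∉ ({j ∈ S | x j = true} : Finset (Fin n)) := by simp [hi]
  congr 1 <;> refine pr_congr fun x => and_congr_left fun hx => ?_
  · rw [Finset.filter_insert, if_pos hx, card_insert_of_notMem (hi' x)]
    omega
  · rw [Finset.filter_insert, if_neg hx]

/-- If `T` has at least as many variables as `S` above every threshold of a rank `r` along which
`p` is monotone, then the number of ones in `T` stochastically dominates that in `S`. -/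
lemma pr_card_le_of_rank (hp : ∀ i, 0 ≤ p i ∧ p i ≤ 1) (r : Fin n → ℕ)
    (hr : ∀ i j, r i ≤ r j → p i ≤ p j) (S T : Finset (Fin n))
    (hST : ∀ c, #{i ∈ S | c ≤ r i} ≤ #{i ∈ T | c ≤ r i}) (t : ℕ) :
    pr p (fun x => t ≤ #{i ∈ S | x i = true}) ≤ pr p (fun x => t ≤ #{i ∈ T | x i = true}) := by
  induction hm : #S generalizing S T t with
  | zero =>
    rw [card_eq_zero] at hm
    subst hm
    exact pr_mono hp fun x hx => le_trans hx (by simp)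
  | succ m ih =>
    cases t with
    | zero => exact pr_mono hp fun x _ => Nat.zero_le _
    | succ t =>
      obtain ⟨j, hjS, hj⟩ := Finset.exists_max_image S r (card_pos.mp (by omega))
      have hjc := hST (r j)
      obtain ⟨i₀, hi₀⟩ : ({i ∈ T | r j ≤ r i} : Finset (Fin n)).Nonempty :=
        card_pos.mp (lt_of_lt_of_le (card_pos.mpr ⟨j, by simp [hjS]⟩) hjc)
      rw [mem_filter] at hi₀
      obtain ⟨i, hiT, hi⟩ := Finset.exists_max_image T r ⟨i₀, hi₀.1⟩
      have hji : r j ≤ r i := hi₀.2.trans (hi i₀ hi₀.1)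
      have hdom : ∀ c, #{l ∈ S.erase j | c ≤ r l} ≤ #{l ∈ T.erase i | c ≤ r l} := by
        intro c
        rw [filter_erase, filter_erase]
        by_cases hc : c ≤ r j
        · rw [card_erase_of_mem (by simp [hjS, hc]),
            card_erase_of_mem (by simp [hiT, hc.trans hji])]
          exact Nat.sub_le_sub_right (hST c) 1
        · rw [Finset.filter_eq_empty_iff.mpr fun l hl h => hc (h.trans (hj l hl))]
          simp
      have hcard : #(S.erase j) = m := by rw [card_erase_of_mem hjS]; omega
      have h₀ := ih _ _ hdom t hcard
      have h₁ := ih _ _ hdom (t + 1) hcard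
      have hT := pr_mono hp (P := fun x => t + 1 ≤ #{l ∈ T.erase i | x l = true})
        (Q := fun x => t ≤ #{l ∈ T.erase i | x l = true}) fun x hx => by omega
      rw [← insert_erase hjS, ← insert_erase hiT, pr_card_insert (by simp),
        pr_card_insert (by simp)]
      have hpij := hr j i hji
      nlinarith [mul_nonneg (sub_nonneg.mpr hpij) (sub_nonneg.mpr hT),
        mul_nonneg (hp j).1 (sub_nonneg.mpr h₀),
        mul_nonneg (sub_nonneg.mpr (hp j).2) (sub_nonneg.mpr h₁)]

end ProductMeasure

section Dominance

variable {n : ℕ} {p : Fin n → ℝ} {V W : Finset (Fin n)}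

lemma Dominates.pr_ones_le (h : Dominates V W) (hp : ∀ i, 0 ≤ p i ∧ p i ≤ 1)
    (hmono : ∀ i j : Fin n, i ≤ j → p i ≤ p j) (t : ℕ) :
    pr p (fun x => t ≤ #{i ∈ W | x i = true}) ≤ pr p (fun x => t ≤ #{i ∈ V | x i = true}) := by
  refine pr_card_le_of_rank hp (fun i => (i : ℕ)) (fun i j hij => hmono i j hij) W V ?_ t
  intro c
  by_cases hc : c < n
  · have := (h.2 (n - c) (by simp; omega)).2
    rwa [Nat.sub_sub_self hc.le] at this
  · rw [Finset.filter_eq_empty_iff.mpr fun (i : Fin n) _ hi => hc (hi.trans_lt i.isLt)]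
    simp

lemma Dominates.pr_zeros_le (h : Dominates V W) (hp : ∀ i, 0 ≤ p i ∧ p i ≤ 1)
    (hmono : ∀ i j : Fin n, i ≤ j → p i ≤ p j) (t : ℕ) :
    pr p (fun x => t ≤ #{i ∈ W | (!x i) = true}) ≤
      pr p (fun x => t ≤ #{i ∈ V | (!x i) = true}) := by
  rw [← pr_comp_not, ← pr_comp_not (p := p) (fun x => t ≤ #{i ∈ V | (!x i) = true})]
  simp only [Bool.not_not]
  refine pr_card_le_of_rank (fun i => by constructor <;> linarith [(hp i).1, (hp i).2])
    (fun i => n - (i : ℕ)) (fun i j hij => ?_) W V ?_ t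
  · have : j ≤ i := by
      rw [Fin.le_def]
      omega
    linarith [hmono j i this]
  intro c
  have key : ∀ S : Finset (Fin n), c ≤ n →
      ({i ∈ S | c ≤ n - (i : ℕ)} : Finset (Fin n)) =
        ({i ∈ S | (i : ℕ) < min n (n - c + 1)} : Finset (Fin n)) := by
    intro S hc
    refine Finset.filter_congr fun i _ => ?_
    have := i.isLt
    omega
  by_cases hc : c ≤ n
  · rw [key W hc, key V hc]
    rcases Nat.eq_zero_or_pos n with rfl | hn
    · simp
    · exact (h.2 _ (by simp; omega)).1
  · rw [Finset.filter_eq_empty_iff.mpr fun (i : Fin n) _ hi => by omega]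
    simp

end Dominance

section Policies

variable {n k : ℕ} {σ : List (Fin n)} {x : Fin n → Bool}

lemma stops_iff_card (hσ : σ.Nodup) (m : ℕ) :
    Stops n k σ x m ↔ k ≤ #{i ∈ (σ.take m).toFinset | x i = true} ∨
      n - k + 1 ≤ #{i ∈ (σ.take m).toFinset | (!x i) = true} := by
  have hnd : (σ.take m).Nodup := hσ.sublist (List.take_sublist m σ)
  have key : ∀ q : Fin n → Bool,
      ((σ.take m).filter q).length = #{i ∈ (σ.take m).toFinset | q i = true} := by
    intro q
    rw [← List.toFinset_filter, List.toFinset_card_of_nodup (hnd.filter q)]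
  rw [Stops, key, key]

lemma card_ones_add_card_zeros (S : Finset (Fin n)) (x : Fin n → Bool) :
    #{i ∈ S | x i = true} + #{i ∈ S | (!x i) = true} = #S := by
  rw [← Finset.card_filter_add_card_filter_not (s := S) (fun i => x i = true)]
  simp

lemma Stops.mono {m m' : ℕ} (h : Stops n k σ x m) (hm : m ≤ m') : Stops n k σ x m' := by
  have hsub : ∀ q : Fin n → Bool,
      ((σ.take m).filter q).length ≤ ((σ.take m').filter q).length := fun q =>
    ((List.take_sublist_take_left hm).filter q).length_le
  exact h.imp (fun h => h.trans (hsub _)) (fun h => h.trans (hsub _))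

lemma stops_length (hkn : k ≤ n) (hσ : σ.Nodup) (hlen : σ.length = n) : Stops n k σ x n := by
  rw [stops_iff_card hσ]
  have := card_ones_add_card_zeros (σ.take n).toFinset x
  rw [List.toFinset_card_of_nodup (hσ.sublist (List.take_sublist n σ)), List.length_take, hlen,
    min_self] at this
  omega

lemma not_stops_of_lt_cost {m : ℕ} (hm : m ≤ σ.length) (h : m < cost n k σ x) :
    ¬ Stops n k σ x m := by
  intro hs
  rw [cost, if_pos ⟨m, hm, hs⟩] at h
  exact absurd (Nat.sInf_le (s := {l | Stops n k σ x l}) hs) (by omega)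

lemma lt_cost_of_not_stops (hkn : k ≤ n) (hσ : σ.Nodup) (hlen : σ.length = n) {m : ℕ}
    (h : ¬ Stops n k σ x m) : m < cost n k σ x := by
  have hn := stops_length (x := x) hkn hσ hlen
  rw [cost, if_pos ⟨n, hlen.ge, hn⟩]
  by_contra hlt
  exact h (Stops.mono (Nat.sInf_mem (s := {l | Stops n k σ x l}) ⟨n, hn⟩) (not_lt.mp hlt))

lemma pr_stops_eq (p : Fin n → ℝ) (hkn : k ≤ n) (hσ : σ.Nodup) (m : ℕ) :
    pr p (fun x => Stops n k σ x m) =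
      pr p (fun x => k ≤ #{i ∈ (σ.take m).toFinset | x i = true}) +
        pr p (fun x => n - k + 1 ≤ #{i ∈ (σ.take m).toFinset | (!x i) = true}) := by
  rw [← pr_or]
  · exact pr_congr fun x => stops_iff_card hσ m
  · intro x h₁ h₂
    have h := card_ones_add_card_zeros (σ.take m).toFinset x
    have h' := Finset.card_le_univ (σ.take m).toFinset
    rw [Fintype.card_fin] at h'
    omega

/-- A prefix whose set of tests dominates another one is less likely to leave the value of the
function undetermined. -/
lemma pr_not_stops_le_of_dominates {p : Fin n → ℝ} {τ : List (Fin n)} {m l : ℕ}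
    (hp : ∀ i, 0 ≤ p i ∧ p i ≤ 1) (hmono : ∀ i j : Fin n, i ≤ j → p i ≤ p j) (hkn : k ≤ n)
    (hσ : σ.Nodup) (hτ : τ.Nodup)
    (hdom : Dominates (σ.take m).toFinset (τ.take l).toFinset) :
    pr p (fun x => ¬ Stops n k σ x m) ≤ pr p (fun x => ¬ Stops n k τ x l) := by
  have hs := pr_and_add_pr_and_not (p := p) (fun _ => True) (fun x => Stops n k σ x m)
  have ht := pr_and_add_pr_and_not (p := p) (fun _ => True) (fun x => Stops n k τ x l)
  simp only [true_and] at hs ht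
  rw [pr_stops_eq p hkn hσ] at hs
  rw [pr_stops_eq p hkn hτ] at ht
  linarith [hdom.pr_ones_le hp hmono k, hdom.pr_zeros_le hp hmono (n - k + 1)]

end Policies

lemma biUnion_blocks_eq_take {α : Type*} [DecidableEq α] (σ : List α) (s : ℕ → ℕ)
    (W : ℕ → Finset α) (b : ℕ)
    (h : ∀ i ∈ Finset.Icc 1 b, W i =
      ((σ.take (∑ i' ∈ Finset.Icc 1 i, s i')).drop
        (∑ i' ∈ Finset.Icc 1 (i - 1), s i')).toFinset) (i : ℕ) (hi : i ≤ b) :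
    (Finset.Icc 1 i).biUnion W = (σ.take (∑ i' ∈ Finset.Icc 1 i, s i')).toFinset := by
  induction i with
  | zero => simp
  | succ i ih =>
    have hsum := Finset.sum_Icc_succ_top (show 1 ≤ i + 1 by omega) s
    rw [← Finset.insert_Icc_right_eq_Icc_add_one (by omega), biUnion_insert, ih (by omega),
      h (i + 1) (by simp; omega), Nat.add_sub_cancel, union_comm,
      Finset.insert_Icc_right_eq_Icc_add_one (by omega)]
    conv_rhs => rw [← List.take_append_drop (∑ i' ∈ Finset.Icc 1 i, s i')
      (σ.take (∑ i' ∈ Finset.Icc 1 (i + 1), s i')), List.toFinset_append, List.take_take,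
      min_eq_left (by omega)]

/-- bounding the cost of a bucketed policy `π` dominating the buckets of an
optimal non-adaptive policy `π*`: for every `ℓ` with `a ≤ ℓ ≤ a'`,
`Pr[cost(π) ≥ ℓ] ≤ Pr[(1+2ε)³·cost(π*) ≥ ℓ]`. -/
theorem stmt_11 (n k : ℕ) (hk1 : 1 ≤ k) (hkn : k ≤ n)
    (p : Fin n → ℝ) (hp : ∀ i, 0 < p i ∧ p i < 1)
    (hmono : ∀ i j : Fin n, i ≤ j → p i ≤ p j)
    (ε : ℝ) (hε : 0 < ε)
    (a a' : ℕ) (ha : 2 * (1 + ε) ^ 2 / ε ≤ (a : ℝ)) (haa' : a < a') (ha'n : a' ≤ n)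
    (b : ℕ) (hb : 1 ≤ b)
    -- the optimal non-adaptive policy and its consecutive blocks
    (πstar : List (Fin n)) (hπstar : πstar.Nodup) (hπstarlen : πstar.length = n)
    (s : ℕ → ℕ) (Vstar : ℕ → Finset (Fin n))
    (hsize : ∀ i ∈ Finset.Icc 1 b, (Vstar i).card = s i)
    (hblocks : ∀ i ∈ Finset.Icc 1 b, Vstar i =
      ((πstar.take (∑ i' ∈ Finset.Icc 1 i, s i')).drop
        (∑ i' ∈ Finset.Icc 1 (i - 1), s i')).toFinset)
    (hs1 : s 1 = ⌊((a : ℝ) - 1) / (1 + 2 * ε)⌋₊)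
    (hsi : ∀ i ∈ Finset.Icc 2 b, s i ≤ ⌈ε * (s 1 : ℝ)⌉₊)
    (hLb : a' ≤ ∑ i' ∈ Finset.Icc 1 b, s i')
    -- the dominating disjoint sets and the corresponding bucketed partial policy
    (V : ℕ → Finset (Fin n))
    (hVdisj : ∀ i ∈ Finset.Icc 1 b, ∀ i' ∈ Finset.Icc 1 b, i ≠ i' →
      Disjoint (V i) (V i'))
    (hVdom : ∀ i ∈ Finset.Icc 1 b,
      Dominates ((Finset.Icc 1 i).biUnion V) ((Finset.Icc 1 i).biUnion Vstar))
    (hVcard : ∀ i ∈ Finset.Icc 1 b, ((V i).card : ℝ) ≤ (1 + 2 * ε) * (s i : ℝ))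
    (π : List (Fin n)) (hπ : π.Nodup)
    (hπlen : π.length = ∑ i ∈ Finset.Icc 1 b, (V i).card)
    (hπblocks : ∀ i ∈ Finset.Icc 1 b,
      (π.take (∑ i' ∈ Finset.Icc 1 i, (V i').card)).toFinset =
        (Finset.Icc 1 i).biUnion V) :
    ∀ ℓ : ℕ, a ≤ ℓ → ℓ ≤ a' →
      pr p (fun x => ℓ ≤ cost n k π x) ≤
        pr p (fun x => (ℓ : ℝ) ≤ (1 + 2 * ε) ^ 3 * (cost n k πstar x : ℝ)) := by
  intro ℓ haℓ hℓa'
  have hp' : ∀ i, 0 ≤ p i ∧ p i ≤ 1 := fun i => ⟨(hp i).1.le, (hp i).2.le⟩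
  set M : ℕ → ℕ := fun i => ∑ i' ∈ Finset.Icc 1 i, (V i').card with hM
  set L : ℕ → ℕ := fun i => ∑ i' ∈ Finset.Icc 1 i, s i' with hL
  have ha0 : 1 ≤ a := by
    have : (0 : ℝ) < a := lt_of_lt_of_le (by positivity) ha
    exact_mod_cast this
  have hM1 : M 1 < ℓ := by
    have h₁ := hVcard 1 (by simp; omega)
    have ha1 : (1 : ℝ) ≤ a := by exact_mod_cast ha0
    have h₂ : (s 1 : ℝ) ≤ ((a : ℝ) - 1) / (1 + 2 * ε) := by
      rw [hs1]
      exact Nat.floor_le (div_nonneg (by linarith) (by positivity))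
    rw [le_div_iff₀ (by positivity)] at h₂
    have h₃ : ((#(V 1) + 1 : ℕ) : ℝ) ≤ a := by push_cast; linarith
    have h₄ : #(V 1) + 1 ≤ a := by exact_mod_cast h₃
    simp only [hM, Finset.Icc_self, Finset.sum_singleton]
    omega
  have hunion : ∀ i ≤ b, (Finset.Icc 1 i).biUnion Vstar = (πstar.take (L i)).toFinset :=
    biUnion_blocks_eq_take πstar s Vstar b hblocks
  have hLM : ∀ i ≤ b, (M i : ℝ) ≤ (1 + 2 * ε) * L i := by
    intro i hi
    simp only [hM, hL]
    push_cast
    rw [Finset.mul_sum]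
    refine Finset.sum_le_sum fun j hj => hVcard j ?_
    rw [Finset.mem_Icc] at hj ⊢
    omega
  have hMb : ℓ ≤ M b := by
    have h₁ := (hVdom b (by simp; omega)).1
    rw [hunion b le_rfl, List.toFinset_card_of_nodup (hπstar.sublist (List.take_sublist _ _)),
      List.length_take, hπstarlen] at h₁
    have h₂ : #((Finset.Icc 1 b).biUnion V) ≤ M b := card_biUnion_le
    have h₃ : a' ≤ L b := hLb
    omega
  obtain ⟨i, hi1, hib, hMi, hMi1⟩ : ∃ i, 1 ≤ i ∧ i + 1 ≤ b ∧ M i < ℓ ∧ ℓ ≤ M (i + 1) := by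
    classical
    have hex : ∃ j, ℓ ≤ M j := ⟨b, hMb⟩
    have hspec := Nat.find_spec hex
    have hle : Nat.find hex ≤ b := Nat.find_min' hex hMb
    have h0 : Nat.find hex ≠ 0 := fun h => by
      rw [h] at hspec
      simp only [hM] at hspec
      simp at hspec
      omega
    have h1 : Nat.find hex ≠ 1 := fun h => by
      rw [h] at hspec
      omega
    refine ⟨Nat.find hex - 1, by omega, by omega, not_le.mp (Nat.find_min hex (by omega)), ?_⟩
    rwa [Nat.sub_add_cancel (by omega)]
  have hlen : M i ≤ π.length := by
    rw [hπlen]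
    exact Finset.sum_le_sum_of_subset (Finset.Icc_subset_Icc_right (by omega))
  have hbound : (ℓ : ℝ) ≤ (1 + 2 * ε) ^ 3 * (L i + 1) := by
    have h₁ : (ℓ : ℝ) ≤ M (i + 1) := by exact_mod_cast hMi1
    have h₂ := hLM (i + 1) hib
    have h₃ : L (i + 1) = L i + s (i + 1) := Finset.sum_Icc_succ_top (by omega) s
    have h₄ : (s (i + 1) : ℝ) ≤ ε * s 1 + 1 :=
      (Nat.cast_le.mpr (hsi (i + 1) (by simp; omega))).trans
        (Nat.ceil_lt_add_one (by positivity)).le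
    have h₅ : (s 1 : ℝ) ≤ L i := by
      exact_mod_cast Finset.single_le_sum (f := s) (fun _ _ => Nat.zero_le _)
        (Finset.mem_Icc.mpr ⟨le_rfl, hi1⟩)
    have h₆ : (L (i + 1) : ℝ) ≤ (1 + 2 * ε) * (L i + 1) := by
      rw [h₃]
      push_cast
      nlinarith [Nat.cast_nonneg (α := ℝ) (L i)]
    calc (ℓ : ℝ) ≤ (1 + 2 * ε) * L (i + 1) := h₁.trans h₂
      _ ≤ (1 + 2 * ε) * ((1 + 2 * ε) * (L i + 1)) := by gcongr
      _ = (1 + 2 * ε) ^ 2 * (L i + 1) := by ring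
      _ ≤ (1 + 2 * ε) ^ 3 * (L i + 1) := by
        gcongr
        · linarith
        · norm_num
  have hdom : Dominates (π.take (M i)).toFinset (πstar.take (L i)).toFinset := by
    rw [hπblocks i (by simp; omega), ← hunion i (by omega)]
    exact hVdom i (by simp; omega)
  calc pr p (fun x => ℓ ≤ cost n k π x)
      ≤ pr p (fun x => ¬ Stops n k π x (M i)) :=
        pr_mono hp' fun x hx => not_stops_of_lt_cost hlen (hMi.trans_le hx)
    _ ≤ pr p (fun x => ¬ Stops n k πstar x (L i)) :=
        pr_not_stops_le_of_dominates hp' hmono hkn hπ hπstar hdom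
    _ ≤ _ := pr_mono hp' fun x hx => by
        have h : ((L i + 1 : ℕ) : ℝ) ≤ cost n k πstar x :=
          Nat.cast_le.mpr (lt_cost_of_not_stops hkn hπstar hπstarlen hx)
        push_cast at h
        exact hbound.trans (by gcongr)
end
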